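/- Let V be a complex Banach space with an injective linear map ι into the entire functions on ℂ^d satisfying the continuous-inclusion bounds. Assume: (1) Assumption (II) holds for (V, p) for every p ∈ ℂ^d; and (2) for every real a with 0 < a < 1 and every U ∈ SU(d) (a d×d complex matrix with U*U = I and det U = 1), there exists an entire nonvanishing function v : ℂ^d → ℂ such that the weighted composition operator with weight v and symbol z ↦ a·(U z) is bounded on V. Let f : ℂ^d → ℂ^d be holomorphic and u : ℂ^d → ℂ entire and nonvanishing (u(z) ≠ 0 for all z). If the weighted composition operator uC_f is bounded on V, then f is affine. -/

import Mathlib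

open Complex in
theorem differentiable_fderiv_apply_complex {E : Type*} [NormedAddCommGroup E]
    [NormedSpace ℂ E] [FiniteDimensional ℂ E] {F : E → ℂ} (hF : Differentiable ℂ F) (y : E) :
    Differentiable ℂ fun z => fderiv ℂ F z y := by
  have : ProperSpace E := FiniteDimensional.proper ℂ E
  borelize E
  set k : ℝ → ℂ := fun θ => deriv (circleMap 0 1) θ * ((circleMap 0 1 θ) ^ 2)⁻¹ with hk
  have hk_cont : Continuous k := by
    simp only [hk, deriv_circleMap]
    refine ((continuous_circleMap 0 1).mul continuous_const).mul
      (((continuous_circleMap 0 1).pow 2).inv₀ fun θ => ?_)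
    exact pow_ne_zero _ (circleMap_ne_center one_ne_zero)
  have hk_norm : ∀ θ, ‖k θ‖ = 1 := fun θ => by simp [hk, deriv_circleMap]
  have hrep : ∀ z, fderiv ℂ F z y
      = (2 * Real.pi * I : ℂ)⁻¹ * ∫ θ in (0 : ℝ)..2 * Real.pi,
          k θ * F (z + circleMap 0 1 θ • y) := by
    intro z
    have hline : Differentiable ℂ fun t : ℂ => F (z + t • y) := by fun_prop
    have h1 : HasDerivAt (fun t : ℂ => F (z + t • y)) (fderiv ℂ F z y) 0 := by
      have h2 : HasDerivAt (fun t : ℂ => z + t • y) y 0 := by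
        simpa using ((hasDerivAt_id (0 : ℂ)).smul_const y).const_add z
      have h3 : HasFDerivAt F (fderiv ℂ F z) (z + (0 : ℂ) • y) := by
        simpa using (hF z).hasFDerivAt
      exact h3.comp_hasDerivAt (0 : ℂ) h2
    rw [← h1.deriv, ← two_pi_I_inv_smul_circleIntegral_sub_sq_inv_smul_of_differentiable
      (R := 1) isOpen_univ (Set.subset_univ _) hline.differentiableOn (Metric.mem_ball_self one_pos)]
    simp only [circleIntegral, hk, sub_zero, smul_eq_mul, mul_assoc]
  intro z₀
  have hcont : ∀ z, Continuous fun θ => F (z + circleMap 0 1 θ • y) := fun z =>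
    hF.continuous.comp (continuous_const.add ((continuous_circleMap 0 1).smul continuous_const))
  obtain ⟨C, hC⟩ := (isCompact_closedBall z₀ (2 + ‖y‖)).exists_bound_of_continuousOn
    hF.continuous.continuousOn
  have hC0 : 0 ≤ C := (norm_nonneg _).trans (hC z₀ (Metric.mem_closedBall_self (by positivity)))
  have hbound : ∀ z ∈ Metric.ball z₀ (1 + ‖y‖), ‖fderiv ℂ F z‖ ≤ 2 * C := by
    intro z hz
    have h := Complex.norm_fderiv_le_div_of_mapsTo_ball (f := F) (c := z) (R₁ := 1) (R₂ := 2 * C)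
      hF.differentiableOn (fun w hw => ?_) one_pos
    · simpa using h
    · rw [Metric.mem_ball, dist_eq_norm] at hz hw
      have hz' : z ∈ Metric.closedBall z₀ (2 + ‖y‖) := by
        rw [Metric.mem_closedBall, dist_eq_norm]; linarith
      have hw' : w ∈ Metric.closedBall z₀ (2 + ‖y‖) := by
        rw [Metric.mem_closedBall, dist_eq_norm]
        have := norm_add_le (w - z) (z - z₀)
        rw [sub_add_sub_cancel] at this
        linarith
      rw [Metric.mem_closedBall, dist_eq_norm]
      have := norm_sub_le (F w) (F z)
      linarith [hC w hw', hC z hz']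
  have hshift : ∀ θ, ∀ z ∈ Metric.ball z₀ 1,
      z + circleMap 0 1 θ • y ∈ Metric.ball z₀ (1 + ‖y‖) := by
    intro θ z hz
    rw [Metric.mem_ball, dist_eq_norm] at hz ⊢
    have := norm_add_le (z - z₀) (circleMap 0 1 θ • y)
    rw [norm_smul, norm_circleMap_zero, abs_one, one_mul] at this
    rw [add_sub_right_comm]
    linarith
  have hLip : LipschitzOnWith (2 * C).toNNReal F (Metric.ball z₀ (1 + ‖y‖)) :=
    (convex_ball z₀ (1 + ‖y‖)).lipschitzOnWith_of_nnnorm_fderiv_le (𝕜 := ℂ) (fun z _ => hF z)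
      fun z hz => by
        rw [← NNReal.coe_le_coe, coe_nnnorm, Real.coe_toNNReal _ (by positivity)]
        exact hbound z hz
  have hmain := (intervalIntegral.hasFDerivAt_integral_of_dominated_loc_of_lip (𝕜 := ℂ)
    (μ := MeasureTheory.volume) (a := 0) (b := 2 * Real.pi) (s := Metric.ball z₀ 1)
    (F := fun z θ => k θ * F (z + circleMap 0 1 θ • y))
    (F' := fun θ => k θ • fderiv ℂ F (z₀ + circleMap 0 1 θ • y)) (x₀ := z₀)
    (bound := fun _ => 2 * C)
    (Metric.ball_mem_nhds _ one_pos)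
    (Filter.Eventually.of_forall fun z => (hk_cont.mul (hcont z)).aestronglyMeasurable)
    ((hk_cont.mul (hcont z₀)).intervalIntegrable _ _) ?_ ?_
    intervalIntegrable_const ?_).2
  · have := hmain.differentiableAt.const_mul (2 * Real.pi * I : ℂ)⁻¹
    exact this.congr_of_eventuallyEq (Filter.Eventually.of_forall hrep)
  · refine (hk_cont.measurable.smul ((measurable_fderiv ℂ F).comp ?_)).aestronglyMeasurable
    exact (continuous_const.add ((continuous_circleMap 0 1).smul continuous_const)).measurable
  · refine Filter.Eventually.of_forall fun θ _ => ?_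
    refine LipschitzOnWith.of_dist_le_mul fun z hz w hw => ?_
    have h := hLip.dist_le_mul _ (hshift θ z hz) _ (hshift θ w hw)
    rw [dist_eq_norm, ← mul_sub, norm_mul, hk_norm, one_mul, ← dist_eq_norm]
    rw [Real.coe_toNNReal _ (by positivity)] at h
    simpa [abs_of_nonneg hC0] using h
  · refine Filter.Eventually.of_forall fun θ _ => ?_
    have h2 : HasFDerivAt (fun z : E => z + circleMap 0 1 θ • y) (ContinuousLinearMap.id ℂ E) z₀ :=
      (hasFDerivAt_id z₀).add_const _
    have h3 := ((hF (z₀ + circleMap 0 1 θ • y)).hasFDerivAt.comp z₀ h2).const_mul (k θ)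
    simpa using h3

theorem contDiff_of_differentiable_complex {E : Type*} [NormedAddCommGroup E]
    [NormedSpace ℂ E] [FiniteDimensional ℂ E] {F : E → ℂ} (hF : Differentiable ℂ F) (n : ℕ) :
    ContDiff ℂ n F := by
  induction n generalizing F with
  | zero => exact contDiff_zero.2 hF.continuous
  | succ n ih =>
    push_cast
    exact contDiff_succ_iff_fderiv_apply.2
      ⟨hF, by simp, fun y => ih (differentiable_fderiv_apply_complex hF y)⟩

universe u in
open Asymptotics Topology in
theorem ContDiff.isLittleO_of_iteratedFDeriv_eq_zero {E G : Type u} [NormedAddCommGroup E]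
    [NormedSpace ℂ E] [NormedAddCommGroup G] [NormedSpace ℂ G] {w : E → G} {p : E} {n : ℕ}
    (hw : ContDiff ℂ n w) (h0 : ∀ k < n + 1, iteratedFDeriv ℂ k w p = 0) :
    w =o[𝓝 p] fun z => ‖z - p‖ ^ n := by
  induction n generalizing G with
  | zero =>
    have h : w p = 0 := by
      have := h0 0 (by simp)
      rw [← norm_eq_zero, norm_iteratedFDeriv_zero, norm_eq_zero] at this
      exact this
    simp only [pow_zero, isLittleO_one_iff]
    simpa [h] using hw.continuous.tendsto p
  | succ n ih =>
    push_cast at hw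
    have hw' := contDiff_succ_iff_fderiv.1 hw
    have h1 := ih hw'.2.2 fun k hk => by
      have := h0 (k + 1) (by omega)
      rw [← norm_eq_zero, ← norm_iteratedFDeriv_fderiv, norm_eq_zero] at this
      exact this
    have hp : w p = 0 := by
      have := h0 0 (by simp)
      rw [← norm_eq_zero, norm_iteratedFDeriv_zero, norm_eq_zero] at this
      exact this
    rw [isLittleO_iff] at h1 ⊢
    intro c hc
    obtain ⟨r, hr, hball⟩ := Metric.eventually_nhds_iff_ball.1 (h1 hc)
    refine Metric.eventually_nhds_iff_ball.2 ⟨r, hr, fun z hz => ?_⟩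
    have hsub : Metric.closedBall p ‖z - p‖ ⊆ Metric.ball p r :=
      Metric.closedBall_subset_ball (by simpa [dist_eq_norm] using hz)
    have := (convex_closedBall (E := E) p ‖z - p‖).norm_image_sub_le_of_norm_fderiv_le (𝕜 := ℂ)
      (f := w) (C := c * ‖z - p‖ ^ n) (x := p) (y := z) (fun x _ => hw'.1 x) (fun x hx => ?_)
      (Metric.mem_closedBall_self (norm_nonneg _)) (by simp [dist_eq_norm])
    · simpa [hp, pow_succ, mul_assoc] using this
    · refine (hball x (hsub hx)).trans ?_
      rw [norm_pow, norm_norm]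
      have : ‖x - p‖ ≤ ‖z - p‖ := by simpa [dist_eq_norm] using hx
      gcongr

open Asymptotics Topology Filter

theorem norm_coeff_le_of_isLittleO_pow {φ : ℂ → ℂ} (hφ : Differentiable ℂ φ) {A : ℂ} {C : ℝ}
    {n : ℕ} (hA : (fun t => φ t - A * t ^ n) =o[𝓝 0] fun t => t ^ n)
    (hC : ∀ t, ‖t‖ ≤ 1 → ‖φ t‖ ≤ C) : ‖A‖ ≤ C := by
  induction n generalizing φ with
  | zero =>
    simp only [pow_zero, mul_one, isLittleO_one_iff] at hA
    have h1 : Tendsto (fun t => φ t - A) (𝓝 0) (𝓝 (φ 0 - A)) := by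
      exact (hφ.continuous.sub continuous_const).tendsto 0
    rw [← sub_eq_zero.1 (tendsto_nhds_unique h1 hA)]
    exact hC 0 (by simp)
  | succ n ih =>
    have h0 : φ 0 = 0 := by
      have h1 : Tendsto (fun t => φ t - A * t ^ (n + 1)) (𝓝 0) (𝓝 (φ 0 - A * 0 ^ (n + 1))) := by
        refine Continuous.tendsto ?_ 0
        exact hφ.continuous.sub (by fun_prop)
      have h2 : Tendsto (fun t : ℂ => t ^ (n + 1)) (𝓝 0) (𝓝 0) := by
        have : Continuous fun t : ℂ => t ^ (n + 1) := by fun_prop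
        simpa using this.tendsto 0
      simpa using tendsto_nhds_unique h1 (hA.trans_tendsto h2)
    have hfac : ∀ t, φ t = t * dslope φ 0 t := fun t => by
      have := sub_smul_dslope φ 0 t
      simpa [h0] using this.symm
    have hd : Differentiable ℂ (dslope φ 0) := by
      rw [← differentiableOn_univ]
      exact (Complex.differentiableOn_dslope univ_mem).2 hφ.differentiableOn
    have hB : ∀ t, ‖t‖ ≤ 1 → ‖dslope φ 0 t‖ ≤ C := by
      intro t ht
      refine Complex.norm_le_of_forall_mem_frontier_norm_le (U := Metric.ball (0 : ℂ) 1)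
        Metric.isBounded_ball hd.diffContOnCl (fun z hz => ?_) ?_
      · rw [frontier_ball _ one_ne_zero, mem_sphere_zero_iff_norm] at hz
        have := hC z hz.le
        rwa [hfac, norm_mul, hz, one_mul] at this
      · rw [closure_ball _ one_ne_zero]
        simpa using ht
    refine ih hd ?_ hB
    have hpunct : (fun t => dslope φ 0 t - A * t ^ n) =o[𝓝[≠] 0] fun t => t ^ n := by
      have := hA.mono (nhdsWithin_le_nhds (s := {0}ᶜ))
      rw [isLittleO_iff] at this ⊢
      intro c hc
      filter_upwards [this hc, self_mem_nhdsWithin] with t ht ht0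
      have ht0 : 0 < ‖t‖ := norm_pos_iff.2 ht0
      rw [hfac, show t * dslope φ 0 t - A * t ^ (n + 1) = t * (dslope φ 0 t - A * t ^ n) by ring,
        pow_succ', norm_mul, norm_mul] at ht
      rw [show c * (‖t‖ * ‖t ^ n‖) = ‖t‖ * (c * ‖t ^ n‖) by ring] at ht
      exact le_of_mul_le_mul_left ht ht0
    rw [← nhdsNE_sup_pure]
    refine hpunct.sup ?_
    rw [isLittleO_pure]
    have hcl : Tendsto (fun t => dslope φ 0 t - A * t ^ n) (𝓝[≠] 0)
        (𝓝 (dslope φ 0 0 - A * 0 ^ n)) := by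
      have : Continuous fun t => dslope φ 0 t - A * t ^ n := hd.continuous.sub (by fun_prop)
      exact (this.tendsto 0).mono_left nhdsWithin_le_nhds
    rcases Nat.eq_zero_or_pos n with rfl | hn
    · simp only [pow_zero, mul_one, isLittleO_one_iff] at hpunct hcl
      have := tendsto_nhds_unique hcl hpunct
      simpa using this
    · have h2 : Tendsto (fun t : ℂ => t ^ n) (𝓝[≠] 0) (𝓝 0) := by
        have : Continuous fun t : ℂ => t ^ n := by fun_prop
        simpa [hn.ne'] using (this.tendsto 0).mono_left nhdsWithin_le_nhds
      exact tendsto_nhds_unique hcl (hpunct.trans_tendsto h2)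

theorem iteratedFDeriv_clm_sub_pow_eq_zero {E : Type*} [NormedAddCommGroup E] [NormedSpace ℂ E]
    (ξ : E →L[ℂ] ℂ) (p : E) (n k : ℕ) (hk : k < n) :
    iteratedFDeriv ℂ k (fun z => ξ (z - p) ^ n) p = 0 := by
  induction n generalizing k with
  | zero => omega
  | succ n ih =>
    have hL : ContDiff ℂ k fun z => ξ (z - p) :=
      ξ.contDiff.comp (contDiff_id.sub contDiff_const)
    have h := norm_iteratedFDeriv_mul_le (hL.pow n) hL p le_rfl
    simp only [← pow_succ] at h
    rw [← norm_le_zero_iff]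
    refine h.trans_eq (Finset.sum_eq_zero fun i hi => ?_)
    rw [Finset.mem_range] at hi
    rcases lt_or_ge i n with hin | hin
    · rw [ih i hin, norm_zero, mul_zero, zero_mul]
    · obtain rfl : i = n := by omega
      obtain rfl : k = i := by omega
      rw [Nat.sub_self, norm_iteratedFDeriv_zero, sub_self, map_zero, norm_zero, mul_zero]

theorem isLittleO_pow_sub_pow {α : Type*} {l : Filter α} {a b : α → ℂ} {s : α → ℝ}
    (hab : (fun x => a x - b x) =o[l] s) (hb : b =O[l] s) (n : ℕ) :
    (fun x => a x ^ n - b x ^ n) =o[l] fun x => s x ^ n := by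
  have ha : a =O[l] s := by simpa using hab.isBigO.add hb
  induction n with
  | zero => simpa using isLittleO_zero (E' := ℂ) (fun _ : α => (1 : ℝ)) l
  | succ n ih =>
    have h1 := (ha.mul_isLittleO ih).add (hab.mul_isBigO (hb.pow n))
    refine (h1.congr_left fun x => by ring).congr_right fun x => by ring

theorem le_of_forall_pow_le_mul_pow {x y C : ℝ} (hy : 0 ≤ y)
    (h : ∀ k : ℕ, x ^ k ≤ C * y ^ k) : x ≤ y := by
  by_contra! hxy
  rcases hy.eq_or_lt with rfl | hy
  · have := h 1
    simp only [pow_one, mul_zero] at this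
    linarith
  · have h1 : 1 < x / y := (one_lt_div hy).2 hxy
    obtain ⟨k, hk⟩ := pow_unbounded_of_one_lt C h1
    rw [div_pow, lt_div_iff₀ (by positivity)] at hk
    exact absurd (h k) (not_le.2 hk)

/-- A covector which is a left eigenvector of the derivative of the symbol of a bounded weighted
composition operator at a fixed point has eigenvalue of modulus at most one. -/
theorem norm_eigenvalue_le_one_of_bounded_weighted_composition
    {d : ℕ} {V : Type*} [NormedAddCommGroup V] [NormedSpace ℂ V]
    (ι : V → (Fin d → ℂ) → ℂ) (hent : ∀ h : V, Differentiable ℂ (ι h))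
    (hbd : ∀ K : Set (Fin d → ℂ), IsCompact K →
      ∃ C : ℝ, 0 ≤ C ∧ ∀ h : V, ∀ z ∈ K, ‖ι h z‖ ≤ C * ‖h‖)
    {p : Fin d → ℂ}
    (hII : {n : ℕ | ∀ h : (Fin d → ℂ) → ℂ, Differentiable ℂ h →
        (∀ k < n, iteratedFDeriv ℂ k h p = 0) →
        ∃ v : V, ∀ k < n + 1,
          iteratedFDeriv ℂ k (fun z => ι v z - h z) p = 0}.Infinite)
    {g : (Fin d → ℂ) → (Fin d → ℂ)} {g' : (Fin d → ℂ) →L[ℂ] (Fin d → ℂ)}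
    (hg : HasFDerivAt g g' p) (hgp : g p = p)
    {w : (Fin d → ℂ) → ℂ} (hw : ContinuousAt w p) (hwp : w p ≠ 0)
    (S : V →L[ℂ] V) (hS : ∀ h : V, ι (S h) = fun z => w z * ι h (g z))
    {ξ : (Fin d → ℂ) →L[ℂ] ℂ} (hξ : ξ ≠ 0) {μ : ℂ} (hμ : ∀ y, ξ (g' y) = μ * ξ y) :
    ‖μ‖ ≤ 1 := by
  obtain ⟨η, hη⟩ : ∃ η, ξ η = 1 := by
    obtain ⟨y, hy⟩ : ∃ y, ξ y ≠ 0 := by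
      by_contra! h
      exact hξ (ContinuousLinearMap.ext h)
    exact ⟨(ξ y)⁻¹ • y, by simp [hy]⟩
  have hgO : (fun z => g z - p) =O[𝓝 p] fun z => ‖z - p‖ := by
    have := hg.isBigO_sub
    rw [hgp] at this
    exact this.norm_right
  have hgt : Tendsto g (𝓝 p) (𝓝 p) := by simpa [hgp] using hg.continuousAt.tendsto
  have hξO : (fun z => ξ (z - p)) =O[𝓝 p] fun z => ‖z - p‖ :=
    (ξ.isBigO_comp _ _).norm_right
  have hξg : (fun z => ξ (g z - p) - μ * ξ (z - p)) =o[𝓝 p] fun z => ‖z - p‖ := by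
    have h1 := (ξ.isBigO_comp (fun z => g z - g p - g' (z - p)) (𝓝 p)).trans_isLittleO
      hg.isLittleO
    rw [hgp] at h1
    refine h1.norm_right.congr_left fun z => ?_
    rw [map_sub, hμ]
  have hstep : ∀ (n : ℕ) (A : ℂ) (h : (Fin d → ℂ) → ℂ),
      (fun z => h z - A * ξ (z - p) ^ n) =o[𝓝 p] (fun z => ‖z - p‖ ^ n) →
      (fun z => w z * h (g z) - (w p * μ ^ n) * A * ξ (z - p) ^ n) =o[𝓝 p]
        fun z => ‖z - p‖ ^ n := by
    intro n A h hh
    have h1 : (fun z => h (g z) - A * ξ (g z - p) ^ n) =o[𝓝 p] fun z => ‖z - p‖ ^ n :=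
      (hh.comp_tendsto hgt).trans_isBigO (hgO.norm_left.pow n)
    have h2 := (isLittleO_pow_sub_pow hξg (hξO.const_mul_left μ) n).const_mul_left A
    have h3 : (fun z => h (g z) - A * (μ * ξ (z - p)) ^ n) =o[𝓝 p] fun z => ‖z - p‖ ^ n :=
      (h1.add h2).congr_left fun z => by ring
    have h4 : (fun z => h (g z)) =O[𝓝 p] fun z => ‖z - p‖ ^ n := by
      have := h3.isBigO.add (((hξO.const_mul_left μ).pow n).const_mul_left A)
      simpa using this
    have h5 : (fun z => w z - w p) =o[𝓝 p] fun _ => (1 : ℝ) := by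
      rw [isLittleO_one_iff]
      simpa using hw.tendsto.sub_const (w p)
    have h6 := h5.mul_isBigO h4
    refine ((h3.const_mul_left (w p)).add (h6.congr_right fun z => one_mul _)).congr_left
      fun z => by ring
  have hS_bound : ∀ n ∈ {n : ℕ | ∀ h : (Fin d → ℂ) → ℂ, Differentiable ℂ h →
        (∀ k < n, iteratedFDeriv ℂ k h p = 0) →
        ∃ v : V, ∀ k < n + 1, iteratedFDeriv ℂ k (fun z => ι v z - h z) p = 0},
      ‖w p‖ * ‖μ‖ ^ n ≤ ‖S‖ := by
    intro n hn
    have hpoly : Differentiable ℂ fun z => ξ (z - p) ^ n := by fun_prop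
    obtain ⟨v, hv⟩ := hn _ hpoly fun k hk => iteratedFDeriv_clm_sub_pow_eq_zero ξ p n k hk
    have hv0 := (contDiff_of_differentiable_complex ((hent v).sub hpoly) n)
      |>.isLittleO_of_iteratedFDeriv_eq_zero hv
    have hiter : ∀ k : ℕ, (fun z => ι ((S ^ k) v) z - (w p * μ ^ n) ^ k * ξ (z - p) ^ n) =o[𝓝 p]
        fun z => ‖z - p‖ ^ n := by
      intro k
      induction k with
      | zero => exact hv0.congr_left fun z => by simp
      | succ k ih =>
        have := hstep n _ _ ih
        rw [pow_succ' S, mul_apply_eq_comp, hS, pow_succ' (w p * μ ^ n)]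
        exact this
    have hpow : ∀ k : ℕ, ‖(S ^ k) v‖ ≤ ‖S‖ ^ k * ‖v‖ := fun k => by
      induction k with
      | zero => simp
      | succ k ih =>
        rw [pow_succ' S, mul_apply_eq_comp, pow_succ', mul_assoc]
        exact (S.le_opNorm _).trans (by gcongr)
    obtain ⟨C, hC0, hC⟩ := hbd ((fun t : ℂ => p + t • η) '' Metric.closedBall 0 1)
      ((isCompact_closedBall 0 1).image (by fun_prop))
    refine le_of_forall_pow_le_mul_pow (C := C * ‖v‖) (norm_nonneg _) fun k => ?_
    have hline : Tendsto (fun t : ℂ => p + t • η) (𝓝 0) (𝓝 p) := by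
      have : Continuous fun t : ℂ => p + t • η := by fun_prop
      simpa using this.tendsto 0
    have h1 : (fun t : ℂ => ι ((S ^ k) v) (p + t • η) - (w p * μ ^ n) ^ k * t ^ n) =o[𝓝 0]
        fun t => t ^ n := by
      have h2 := (hiter k).comp_tendsto hline
      refine (h2.congr_left fun t => by simp [hη]).trans_isBigO ?_
      refine IsBigO.of_bound (‖η‖ ^ n) (Eventually.of_forall fun t => ?_)
      simp [norm_smul, mul_pow, mul_comm]
    have h2 := norm_coeff_le_of_isLittleO_pow
      ((hent ((S ^ k) v)).comp (by fun_prop : Differentiable ℂ fun t : ℂ => p + t • η)) h1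
      (C := C * ‖(S ^ k) v‖) fun t ht =>
        hC _ _ ⟨t, by simpa using ht, rfl⟩
    rw [norm_pow, norm_mul, norm_pow] at h2
    calc (‖w p‖ * ‖μ‖ ^ n) ^ k ≤ C * ‖(S ^ k) v‖ := h2
      _ ≤ C * (‖S‖ ^ k * ‖v‖) := by
        gcongr
        exact hpow k
      _ = C * ‖v‖ * ‖S‖ ^ k := by ring
  by_contra! hμ1
  obtain ⟨m, hm⟩ := pow_unbounded_of_one_lt (‖S‖ / ‖w p‖) hμ1
  obtain ⟨n, hn, hmn⟩ := hII.exists_gt m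
  have h1 := hS_bound n hn
  have h2 : ‖μ‖ ^ m ≤ ‖μ‖ ^ n := pow_le_pow_right₀ hμ1.le hmn.le
  have h3 : 0 < ‖w p‖ := norm_pos_iff.2 hwp
  rw [div_lt_iff₀ h3] at hm
  nlinarith

theorem eq_add_fderiv_of_linear_growth {E F : Type*} [NormedAddCommGroup E] [NormedSpace ℂ E]
    [NormedAddCommGroup F] [NormedSpace ℂ F] [CompleteSpace F]
    {f : E → F} (hf : Differentiable ℂ f) {C : ℝ} (hC : ∀ z, ‖f z‖ ≤ C * (1 + ‖z‖)) (w : E) :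
    f w = fderiv ℂ f 0 w + f 0 := by
  set φ : ℂ → F := fun t => f (t • w) with hφ
  have hφd : Differentiable ℂ φ := hf.comp (by fun_prop)
  have hd : Differentiable ℂ (dslope φ 0) := by
    rw [← differentiableOn_univ]
    exact (Complex.differentiableOn_dslope univ_mem).2 hφd.differentiableOn
  obtain ⟨M, hM⟩ := (isCompact_closedBall (0 : ℂ) 1).exists_bound_of_continuousOn
    hd.continuous.continuousOn
  have hC0 : 0 ≤ C := by simpa using (norm_nonneg _).trans (hC 0)
  have hbdd : Bornology.IsBounded (Set.range (dslope φ 0)) := by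
    refine isBounded_iff_forall_norm_le.2 ⟨max M (C * (2 + ‖w‖)), ?_⟩
    rintro _ ⟨t, rfl⟩
    rcases le_or_gt ‖t‖ 1 with ht | ht
    · exact (hM t (by simpa using ht)).trans (le_max_left _ _)
    · refine le_trans ?_ (le_max_right _ _)
      have ht0 : t ≠ 0 := norm_pos_iff.1 (by linarith)
      rw [dslope_of_ne _ ht0, slope_def_module, sub_zero, norm_smul, norm_inv,
        inv_mul_le_iff₀ (by linarith)]
      have h1 := hC (t • w)
      have h2 := hC 0
      rw [norm_smul] at h1
      rw [norm_zero, add_zero, mul_one] at h2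
      have h3 := norm_sub_le (φ t) (φ 0)
      simp only [hφ, zero_smul] at h3 ⊢
      nlinarith [norm_nonneg w]
  have h := hd.apply_eq_apply_of_bounded hbdd 1 0
  rw [dslope_of_ne _ one_ne_zero, dslope_same, slope_def_module] at h
  have hder : HasDerivAt φ (fderiv ℂ f 0 w) 0 := by
    have h2 : HasDerivAt (fun t : ℂ => t • w) w 0 := by
      simpa using (hasDerivAt_id (0 : ℂ)).smul_const w
    have h3 : HasFDerivAt f (fderiv ℂ f 0) ((0 : ℂ) • w) := by
      simpa using (hf 0).hasFDerivAt
    exact h3.comp_hasDerivAt (0 : ℂ) h2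
  rw [hder.deriv] at h
  simp only [hφ, sub_zero, inv_one, one_smul, zero_smul] at h
  exact sub_eq_iff_eq_add.1 h

theorem exists_real_ratio_gt_of_deriv_ne {f : ℂ → ℂ} (hf : Differentiable ℂ f) {z₀ : ℂ}
    (hz₀ : z₀ ≠ 0) {c : ℝ} (hc : f z₀ = c * z₀) (hle : ‖deriv f z₀‖ ≤ c)
    (hne : deriv f z₀ ≠ c) {U : Set ℂ} (hU : U ∈ 𝓝 z₀) :
    ∃ z ∈ U, ‖z‖ < ‖z₀‖ ∧ ∃ c' : ℝ, c < c' ∧ f z = c' * z := by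
  have hg : HasStrictDerivAt (fun z => f z / z) ((deriv f z₀ - c) / z₀) z₀ := by
    have h1 : HasStrictDerivAt f (deriv f z₀) z₀ :=
      (hf.analyticAt z₀).hasStrictDerivAt
    have := h1.fun_div (hasStrictDerivAt_id z₀) hz₀
    refine this.congr_deriv ?_
    simp only [id]
    rw [hc]
    field_simp
  have hg' : (deriv f z₀ - c) / z₀ ≠ 0 := div_ne_zero (sub_ne_zero.2 hne) hz₀
  set ζ := hg.localInverse _ _ _ hg' with hζ
  have hval : f z₀ / z₀ = c := by rw [hc, mul_div_cancel_right₀ _ hz₀]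
  have hζd : HasStrictDerivAt ζ ((deriv f z₀ - c) / z₀)⁻¹ (c : ℂ) := by
    have := hg.to_localInverse hg'
    rwa [hval] at this
  have hζc : ζ c = z₀ := by
    have := (hg.hasStrictFDerivAt_equiv hg').localInverse_apply_image
    rwa [hval] at this
  have hright : ∀ᶠ y in 𝓝 (c : ℂ), f (ζ y) / ζ y = y := by
    have := (hg.hasStrictFDerivAt_equiv hg').eventually_right_inverse
    rwa [hval] at this
  set γ : ℝ → ℂ := fun t => ζ (t : ℂ) with hγ
  have hγd : HasDerivAt γ ((deriv f z₀ - c) / z₀)⁻¹ c := hζd.hasDerivAt.comp_ofReal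
  have hN := hγd.norm_sq
  have hγc : γ c = z₀ := hζc
  have hneg : 2 * inner ℝ (γ c) ((deriv f z₀ - c) / z₀)⁻¹ < 0 := by
    rw [hγc, Complex.inner, inv_div]
    set a := deriv f z₀ - c with ha
    have hre : a.re < 0 := by
      have h1 : (deriv f z₀).re ≤ c := (Complex.re_le_norm _).trans hle
      refine lt_of_le_of_ne (by simpa [ha] using h1) fun h => hne ?_
      have h2 : (deriv f z₀).re = c := by simpa [ha, sub_eq_zero] using h
      have h3 : (deriv f z₀).im = 0 := by
        have h4 := Complex.sq_norm (deriv f z₀)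
        rw [Complex.normSq_apply, h2] at h4
        have h5 : 0 ≤ c := (norm_nonneg _).trans hle
        have h6 : ‖deriv f z₀‖ ^ 2 ≤ c ^ 2 := by gcongr
        nlinarith
      exact Complex.ext (by simpa using h2) (by simpa using h3)
    have h1 : (starRingEnd ℂ) z₀ * (z₀ / a) = (Complex.normSq z₀ : ℂ) * a⁻¹ := by
      rw [Complex.normSq_eq_conj_mul_self]; ring
    have hp : 0 < Complex.normSq z₀ := Complex.normSq_pos.2 hz₀
    have ha0 : 0 < Complex.normSq a := Complex.normSq_pos.2 fun h => by simp [h] at hre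
    have h2 : (z₀ / a * (starRingEnd ℂ) z₀).re < 0 := by
      rw [mul_comm, h1, Complex.re_ofReal_mul, Complex.inv_re]
      exact mul_neg_of_pos_of_neg hp (div_neg_of_neg_of_pos hre ha0)
    linarith
  have hcont : Tendsto γ (𝓝[>] c) (𝓝 z₀) := by
    have := hγd.continuousAt.tendsto
    rw [hγc] at this
    exact this.mono_left nhdsWithin_le_nhds
  have hslope : ∀ᶠ t in 𝓝[>] c, ‖γ t‖ ^ 2 < ‖z₀‖ ^ 2 := by
    have h1 := (hasDerivAt_iff_tendsto_slope.1 hN).eventually_lt_const hneg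
    filter_upwards [h1.filter_mono (nhdsWithin_mono c fun t ht => ne_of_gt ht),
      self_mem_nhdsWithin] with t ht htc
    rw [slope_def_field, div_lt_iff₀ (sub_pos.2 htc), zero_mul, hγc] at ht
    linarith
  have hr : ∀ᶠ t : ℝ in 𝓝[>] c, f (γ t) / γ t = t :=
    ((Complex.continuous_ofReal.tendsto c).eventually hright).filter_mono nhdsWithin_le_nhds
  have hne0 : ∀ᶠ t in 𝓝[>] c, γ t ≠ 0 := hcont.eventually_ne hz₀
  obtain ⟨t, ht1, ht2, ht3, ht4, ht5⟩ :=
    (hslope.and (hr.and (hne0.and ((hcont.eventually hU).and self_mem_nhdsWithin)))).exists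
  exact ⟨γ t, ht4, lt_of_pow_lt_pow_left₀ 2 (norm_nonneg _) ht1, t, ht5, (div_eq_iff ht3).1 ht2⟩

theorem exists_real_ratio_gt {f : ℂ → ℂ} (hf : Differentiable ℂ f) {z₀ : ℂ}
    (hz₀ : z₀ ≠ 0) {c : ℝ} (hc : f z₀ = c * z₀) (hne : ∃ z, f z ≠ c * z)
    {U : Set ℂ} (hU : U ∈ 𝓝 z₀) :
    ∃ z ∈ U, ∃ c' : ℝ, c < c' ∧ f z = c' * z := by
  have hval : f z₀ / z₀ = c := by rw [hc, mul_div_cancel_right₀ _ hz₀]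
  have han : AnalyticAt ℂ (fun z => f z / z) z₀ := (hf.analyticAt z₀).div analyticAt_id hz₀
  have hU0 : U ∩ {z | z ≠ 0} ∈ 𝓝 z₀ := inter_mem hU (isOpen_ne.mem_nhds hz₀)
  rcases han.eventually_constant_or_nhds_le_map_nhds with h | h
  · exfalso
    obtain ⟨z, hz⟩ := hne
    have hlin : Differentiable ℂ fun z : ℂ => (c : ℂ) * z := by fun_prop
    have := AnalyticOnNhd.eq_of_eventuallyEq (f := f) (g := fun z => (c : ℂ) * z) (z₀ := z₀)
      (fun z _ => hf.analyticAt z) (fun z _ => hlin.analyticAt z) ?_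
    · exact hz (congrFun this z)
    · filter_upwards [h, isOpen_ne.mem_nhds hz₀] with y hy hy0
      rw [hval] at hy
      exact (div_eq_iff hy0).1 hy
  · rw [hval] at h
    have h1 := h (image_mem_map hU0)
    have h2 : ∀ᶠ t : ℝ in 𝓝[>] c, (t : ℂ) ∈ (fun z => f z / z) '' (U ∩ {z | z ≠ 0}) :=
      ((Complex.continuous_ofReal.tendsto c).eventually h1).filter_mono nhdsWithin_le_nhds
    obtain ⟨t, ⟨z, ⟨hzU, hz0⟩, hz⟩, ht⟩ := (h2.and self_mem_nhdsWithin).exists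
    exact ⟨z, hzU, t, ht, (div_eq_iff hz0).1 hz⟩

theorem exists_norm_eq_forall_deriv_mul_ne {f : ℂ → ℂ} (hf : Differentiable ℂ f)
    (hne : ∃ z, deriv f z * z ≠ f z) (r : ℝ) :
    ∃ R > r, ∀ z, ‖z‖ = R → deriv f z * z ≠ f z := by
  by_contra! h
  have hD : Differentiable ℂ fun z => deriv f z * z - f z :=
    (hf.deriv.mul differentiable_id).sub hf
  set Z : Set ℂ := {z | deriv f z * z - f z = 0} ∩ Metric.closedBall 0 (r + 1) with hZ
  have hinf : Z.Infinite := by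
    refine Set.Infinite.of_image norm ((Set.Ioo_infinite (lt_add_one r)).mono ?_)
    intro R hR
    obtain ⟨z, hz, hz'⟩ := h R hR.1
    exact ⟨z, ⟨sub_eq_zero.2 hz', by simpa [hz] using hR.2.le⟩, hz⟩
  obtain ⟨a, -, ha⟩ := hinf.exists_accPt_of_subset_isCompact
    (isCompact_closedBall (0 : ℂ) (r + 1)) Set.inter_subset_right
  obtain ⟨z, hz⟩ := hne
  have hfreq : ∃ᶠ z in 𝓝[≠] a, deriv f z * z - f z = 0 :=
    (accPt_iff_frequently_nhdsNE.1 ha).mono fun z hz => hz.1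
  have := AnalyticOnNhd.eqOn_zero_of_preconnected_of_frequently_eq_zero
    (fun z _ => hD.analyticAt z) isPreconnected_univ (Set.mem_univ a) hfreq (Set.mem_univ z)
  exact hz (sub_eq_zero.1 this)

theorem exists_forall_ne_real_mul {f : ℂ → ℂ} (hf : Differentiable ℂ f)
    (h : ∀ (z : ℂ) (c : ℝ), 1 < c → z ≠ 0 → f z = c * z → ‖deriv f z‖ ≤ c) :
    ∃ B : ℝ, ∀ z, 1 ≤ ‖z‖ → ∀ c : ℝ, B ≤ c → f z ≠ c * z := by
  obtain ⟨M, hM⟩ := (isCompact_sphere (0 : ℂ) 1).exists_bound_of_continuousOn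
    hf.continuous.continuousOn
  set B := max M 1 + 1 with hB
  have hB1 : 1 < B := by linarith [le_max_right M 1]
  have hsphere : ∀ z, ‖z‖ = 1 → ∀ c : ℝ, B ≤ c → f z ≠ c * z := by
    intro z hz c hc hfz
    have h1 := hM z (by simpa using hz)
    rw [hfz, norm_mul, hz, mul_one, Complex.norm_real, Real.norm_of_nonneg (by linarith)] at h1
    linarith [le_max_left M 1]
  refine ⟨B, fun z₀ hz₀ c₀ hc₀ hfz₀ => ?_⟩
  have hD : ∃ z, deriv f z * z ≠ f z := by
    by_contra! hD
    have hder : ∀ z ∈ ({0}ᶜ : Set ℂ), HasDerivAt (fun z => f z / z) 0 z := fun z hz => by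
      refine ((hf z).hasDerivAt.fun_div (hasDerivAt_id z) hz).congr_deriv ?_
      simp [hD z]
    have hconn : IsPreconnected ({0}ᶜ : Set ℂ) :=
      (isConnected_compl_singleton_of_one_lt_rank (by simp [Complex.rank_real_complex]) 0).2
    obtain ⟨a, ha⟩ := isOpen_compl_singleton.exists_is_const_of_deriv_eq_zero hconn
      (fun z hz => (hder z hz).differentiableAt.differentiableWithinAt)
      (fun z hz => (hder z hz).deriv)
    have hz0 : z₀ ≠ 0 := norm_pos_iff.1 (by linarith)
    have h1 := ha z₀ hz0
    have h2 := ha 1 one_ne_zero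
    rw [hfz₀, mul_div_cancel_right₀ _ hz0] at h1
    refine hsphere 1 (by simp) c₀ hc₀ ?_
    rw [h1, ← h2]
    simp
  obtain ⟨R, hR, hRD⟩ := exists_norm_eq_forall_deriv_mul_ne hf hD ‖z₀‖
  obtain ⟨L, hL⟩ := (isCompact_closedBall (0 : ℂ) R).exists_bound_of_continuousOn
    hf.continuous.continuousOn
  set K : Set (ℂ × ℝ) := {q | ‖q.1‖ ≤ R ∧ 1 ≤ ‖q.1‖ ∧ B ≤ q.2 ∧ f q.1 = q.2 * q.1} with hK
  have hKc : IsCompact K := by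
    refine ((isCompact_closedBall (0 : ℂ) R).prod (isCompact_Icc (a := B) (b := L))).of_isClosed_subset
      ?_ ?_
    · have hfc : Continuous fun q : ℂ × ℝ => f q.1 := hf.continuous.comp continuous_fst
      have e1 : IsClosed {q : ℂ × ℝ | ‖q.1‖ ≤ R} := isClosed_le (by fun_prop) (by fun_prop)
      have e2 : IsClosed {q : ℂ × ℝ | 1 ≤ ‖q.1‖} := isClosed_le (by fun_prop) (by fun_prop)
      have e3 : IsClosed {q : ℂ × ℝ | B ≤ q.2} := isClosed_le (by fun_prop) (by fun_prop)
      have e4 : IsClosed {q : ℂ × ℝ | f q.1 = q.2 * q.1} := isClosed_eq hfc (by fun_prop)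
      exact e1.inter (e2.inter (e3.inter e4))
    · rintro ⟨z, c⟩ ⟨h1, h2, h3, h4⟩
      refine ⟨by simpa using h1, h3, ?_⟩
      have h5 := hL z (by simpa using h1)
      simp only at h2 h3 h4
      rw [h4, norm_mul, Complex.norm_real, Real.norm_of_nonneg (by linarith)] at h5
      nlinarith
  obtain ⟨⟨z, c⟩, ⟨h1, h2, h3, h4⟩, hmax⟩ :=
    hKc.exists_isMaxOn ⟨(z₀, c₀), hR.le, hz₀, hc₀, hfz₀⟩ continuous_snd.continuousOn
  simp only at h1 h2 h3 h4
  have hz0 : z ≠ 0 := norm_pos_iff.1 (by linarith)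
  have hz1 : 1 < ‖z‖ := lt_of_le_of_ne h2 fun he => hsphere z he.symm c h3 h4
  have hU : {x : ℂ | 1 < ‖x‖} ∈ 𝓝 z := (isOpen_lt continuous_const continuous_norm).mem_nhds hz1
  rcases h1.lt_or_eq with hlt | heq
  · have hU' : {x : ℂ | 1 < ‖x‖ ∧ ‖x‖ < R} ∈ 𝓝 z :=
      inter_mem hU ((isOpen_lt continuous_norm continuous_const).mem_nhds hlt)
    obtain ⟨x, ⟨hx1, hx2⟩, c', hc', hfx⟩ := exists_real_ratio_gt hf hz0 h4
      ⟨1, hsphere 1 (by simp) c h3⟩ hU'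
    exact absurd (hmax (show (x, c') ∈ K from ⟨hx2.le, hx1.le, h3.trans hc'.le, hfx⟩))
      (not_le.2 hc')
  · obtain ⟨x, hx1, hx2, c', hc', hfx⟩ := exists_real_ratio_gt_of_deriv_ne hf hz0 h4
      (h z c (by linarith) hz0 h4) (fun he => hRD z heq (by rw [he, h4])) hU
    exact absurd (hmax (show (x, c') ∈ K from
      ⟨(hx2.trans_eq heq).le, le_of_lt hx1, h3.trans hc'.le, hfx⟩)) (not_le.2 hc')

theorem linear_growth_of_forall_ne_real_mul {f : ℂ → ℂ} (hf : Differentiable ℂ f) {B : ℝ}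
    (h : ∀ z, 1 ≤ ‖z‖ → ∀ c : ℝ, B ≤ c → f z ≠ c * z) :
    ∃ C, ∀ z, ‖f z‖ ≤ C * (1 + ‖z‖) := by
  set k : ℂ → ℂ := fun w => B - w * f w⁻¹ with hk
  set D : Set ℂ := Metric.ball 0 1 with hD
  have hslit : ∀ w ∈ D \ {0}, k w ∈ Complex.slitPlane := by
    rintro w ⟨hw, hw0⟩
    rw [hD, mem_ball_zero_iff] at hw
    by_contra hns
    simp only [Complex.mem_slitPlane_iff, not_or, not_lt, not_not] at hns
    refine h w⁻¹ ?_ (B - (k w).re) (by linarith [hns.1]) ?_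
    · rw [norm_inv]
      exact (one_le_inv₀ (norm_pos_iff.2 hw0)).2 hw.le
    · have h1 : k w = ((k w).re : ℂ) := Complex.ext (by simp) (by simpa using hns.2)
      push_cast
      rw [← h1, hk]
      have : w ≠ 0 := hw0
      field_simp
      ring
  set S : ℂ → ℂ := fun w => Complex.exp (Complex.log (k w) / 2) with hS
  have hS2 : ∀ w ∈ D \ {0}, S w ^ 2 = k w := fun w hw => by
    rw [hS, ← Complex.exp_nat_mul]
    push_cast
    rw [mul_div_cancel₀ _ two_ne_zero, Complex.exp_log (Complex.slitPlane_ne_zero (hslit w hw))]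
  have hSre : ∀ w ∈ D \ {0}, 0 < (S w).re := fun w hw => by
    simp only [hS, Complex.exp_re]
    refine mul_pos (Real.exp_pos _) (Real.cos_pos_of_mem_Ioo ?_)
    have h1 : (Complex.log (k w) / 2).im = (k w).arg / 2 := by
      rw [show (2 : ℂ) = ((2 : ℝ) : ℂ) by simp, Complex.div_ofReal_im, Complex.log_im]
    rw [h1]
    have h2 := Complex.neg_pi_lt_arg (k w)
    have h3 := lt_of_le_of_ne (Complex.arg_le_pi (k w)) (Complex.mem_slitPlane_iff_arg.1 (hslit w hw)).1
    constructor <;> linarith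
  have hSd : ∀ w ∈ D \ {0}, DifferentiableAt ℂ S w := fun w hw => by
    have h1 : DifferentiableAt ℂ k w := by
      have h2 : DifferentiableAt ℂ (fun w : ℂ => f w⁻¹) w :=
        (hf _).comp w (differentiableAt_inv hw.2)
      exact (differentiableAt_const _).sub (differentiableAt_id.mul h2)
    exact ((h1.clog (hslit w hw)).div_const 2).cexp
  have hS1 : ∀ w ∈ D \ {0}, S w + 1 ≠ 0 := fun w hw he => by
    have := congrArg Complex.re he
    simp only [Complex.add_re, Complex.one_re, Complex.zero_re] at this
    linarith [hSre w hw]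
  set Q : ℂ → ℂ := fun w => (S w - 1) / (S w + 1) with hQ
  have hQlt : ∀ w ∈ D \ {0}, ‖Q w‖ < 1 := fun w hw => by
    rw [hQ, norm_div, div_lt_one (norm_pos_iff.2 (hS1 w hw))]
    refine lt_of_pow_lt_pow_left₀ 2 (norm_nonneg _) ?_
    rw [Complex.sq_norm, Complex.sq_norm, Complex.normSq_apply, Complex.normSq_apply]
    simp only [Complex.add_re, Complex.one_re, Complex.sub_re, Complex.sub_im, Complex.add_im,
      Complex.one_im]
    nlinarith [hSre w hw]
  have hDn : D ∈ 𝓝 (0 : ℂ) := Metric.ball_mem_nhds _ one_pos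
  set P := Function.update Q 0 (limUnder (𝓝[≠] 0) Q) with hP
  have hPQ : ∀ w ∈ D \ {0}, P w = Q w := fun w hw => Function.update_of_ne hw.2 _ _
  have hPd : DifferentiableOn ℂ P D := by
    refine Complex.differentiableOn_update_limUnder_of_bddAbove hDn (fun w hw => ?_) ⟨1, ?_⟩
    · exact (((hSd w hw).sub_const 1).div ((hSd w hw).add_const 1) (hS1 w hw)).differentiableWithinAt
    · rintro _ ⟨w, hw, rfl⟩
      exact (hQlt w hw).le
  have hP0 : ‖P 0‖ < 1 := by
    by_contra! hge
    have hloc : IsLocalMax (norm ∘ P) 0 := by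
      filter_upwards [hDn] with w hw
      rcases eq_or_ne w 0 with rfl | hw0
      · exact le_rfl
      · have := hQlt w ⟨hw, hw0⟩
        rw [← hPQ w ⟨hw, hw0⟩] at this
        exact this.le.trans hge
    have hev := Complex.eventually_eq_of_isLocalMax_norm
      (hPd.eventually_differentiableAt hDn) hloc
    obtain ⟨w, ⟨hw1, hw2⟩, hw3⟩ := (((hev.and hDn).filter_mono
      nhdsWithin_le_nhds).and self_mem_nhdsWithin : ∀ᶠ w in 𝓝[≠] (0 : ℂ), _).exists
    have := hQlt w ⟨hw2, hw3⟩
    rw [← hPQ w ⟨hw2, hw3⟩, hw1] at this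
    linarith
  obtain ⟨ρ, hρ0, hρ1⟩ := exists_between hP0
  have hev : ∀ᶠ w in 𝓝 (0 : ℂ), ‖P w‖ < ρ ∧ w ∈ D :=
    ((hPd.differentiableAt hDn).continuousAt.norm.eventually_lt_const hρ0).and hDn
  obtain ⟨δ, hδ, hball⟩ := Metric.eventually_nhds_iff_ball.1 hev
  have hSle : ∀ w ∈ Metric.ball (0 : ℂ) δ, w ≠ 0 → ‖S w‖ ≤ 2 / (1 - ρ) := by
    intro w hw hw0
    obtain ⟨h1, h2⟩ := hball w hw
    have hmem : w ∈ D \ {0} := ⟨h2, hw0⟩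
    rw [hPQ w hmem] at h1
    rw [le_div_iff₀ (by linarith)]
    have h3 : S w - 1 = Q w * (S w + 1) := (div_mul_cancel₀ _ (hS1 w hmem)).symm
    have h4 : ‖S w‖ ≤ ‖Q w‖ * (‖S w‖ + 1) + 1 := by
      calc ‖S w‖ = ‖Q w * (S w + 1) + 1‖ := by rw [← h3, sub_add_cancel]
        _ ≤ ‖Q w * (S w + 1)‖ + ‖(1 : ℂ)‖ := norm_add_le _ _
        _ ≤ _ := by
          rw [norm_mul, norm_one]
          gcongr
          simpa using norm_add_le (S w) 1
    nlinarith [norm_nonneg (S w)]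
  obtain ⟨M, hM⟩ := (isCompact_closedBall (0 : ℂ) δ⁻¹).exists_bound_of_continuousOn
    hf.continuous.continuousOn
  set L := |B| + (2 / (1 - ρ)) ^ 2 with hL
  refine ⟨max M L, fun z => ?_⟩
  rcases le_or_gt ‖z‖ δ⁻¹ with hz | hz
  · have h1 := hM z (by simpa using hz)
    have h2 : 0 ≤ M := (norm_nonneg _).trans h1
    nlinarith [le_max_left M L, norm_nonneg z]
  · have hzpos : 0 < ‖z‖ := (inv_pos.2 hδ).trans hz
    have hz0 : z ≠ 0 := norm_pos_iff.1 hzpos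
    have hwb : z⁻¹ ∈ Metric.ball (0 : ℂ) δ := by
      rw [mem_ball_zero_iff, norm_inv]
      exact inv_lt_of_inv_lt₀ hδ hz
    have h1 := hSle z⁻¹ hwb (inv_ne_zero hz0)
    have h2 := hS2 z⁻¹ ⟨(hball _ hwb).2, inv_ne_zero hz0⟩
    have h3 : f z = z * (B - S z⁻¹ ^ 2) := by
      rw [h2, hk]
      simp only [inv_inv, sub_sub_cancel]
      rw [mul_inv_cancel_left₀ hz0]
    have h4 : ‖f z‖ ≤ ‖z‖ * L := by
      rw [h3, norm_mul]
      gcongr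
      refine (norm_sub_le _ _).trans ?_
      rw [Complex.norm_real, Real.norm_eq_abs, norm_pow, hL]
      gcongr
    have h5 : 0 ≤ L := by positivity
    nlinarith [le_max_right M L]

theorem eq_smul_of_forall_re_neg_le {E : Type*} [NormedAddCommGroup E] [InnerProductSpace ℂ E]
    {z : E} (hz : z ≠ 0) (ℓ : E →ₗ[ℂ] ℂ) {b : ℝ} (hb : 0 ≤ b)
    (h : ∀ ξ : E, (inner ℂ z ξ).re < 0 → (ℓ ξ).re ≤ b * (inner ℂ z ξ).re) :
    (∀ ξ, ℓ ξ = ℓ z / (‖z‖ : ℂ) ^ 2 * inner ℂ z ξ) ∧ b * ‖z‖ ^ 2 ≤ (ℓ z).re := by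
  have hzz : inner ℂ z z = ((‖z‖ : ℂ)) ^ 2 := by
    rw [inner_self_eq_norm_sq_to_K]; rfl
  have hpos : 0 < ‖z‖ := norm_pos_iff.2 hz
  have hzz' : (inner ℂ z z).re = ‖z‖ ^ 2 := by
    rw [hzz]; norm_cast
  have hker : ∀ ξ, inner ℂ z ξ = 0 → ℓ ξ = 0 := by
    intro ξ hξ
    by_contra hne
    have hn : 0 < Complex.normSq (ℓ ξ) := Complex.normSq_pos.2 hne
    set t : ℝ := (1 + (ℓ z).re) / Complex.normSq (ℓ ξ) with ht
    have h1 := h (((t : ℂ) * (starRingEnd ℂ) (ℓ ξ)) • ξ - z) (by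
      rw [inner_sub_right, inner_smul_right, hξ, mul_zero, zero_sub, Complex.neg_re, hzz']
      have := pow_pos hpos 2
      linarith)
    rw [inner_sub_right, inner_smul_right, hξ, mul_zero, zero_sub, Complex.neg_re, hzz', map_sub,
      map_smul, smul_eq_mul, mul_assoc, ← Complex.normSq_eq_conj_mul_self, ← Complex.ofReal_mul,
      Complex.sub_re, Complex.ofReal_re, ht, div_mul_cancel₀ _ hn.ne'] at h1
    have := mul_nonneg hb (sq_nonneg ‖z‖)
    linarith
  constructor
  · intro ξ
    have hc : (‖z‖ : ℂ) ^ 2 ≠ 0 := pow_ne_zero _ (by exact_mod_cast hpos.ne')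
    have h1 := hker (ξ - (inner ℂ z ξ / (‖z‖ : ℂ) ^ 2) • z) (by
      rw [inner_sub_right, inner_smul_right, hzz, div_mul_cancel₀ _ hc, sub_self])
    rw [map_sub, map_smul, smul_eq_mul, sub_eq_zero] at h1
    rw [h1]
    ring
  · have h1 := h (-z) (by
      rw [inner_neg_right, Complex.neg_re, hzz']
      have := pow_pos hpos 2
      linarith)
    rw [inner_neg_right, Complex.neg_re, hzz', map_neg, Complex.neg_re] at h1
    linarith

theorem norm_le_mul_rpow_of_inner_fderiv {E : Type*} [NormedAddCommGroup E]
    [InnerProductSpace ℂ E] [FiniteDimensional ℂ E] {g : E → E} (hg : Differentiable ℂ g)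
    (H : ∀ p κ, 0 < ‖p‖ → ‖p‖ < ‖g p‖ →
      (∀ y, inner ℂ (g p) (fderiv ℂ g p y) = κ * inner ℂ p y) → ‖κ‖ * ‖p‖ ^ 2 ≤ ‖g p‖ ^ 2)
    {M : ℝ} (hM1 : 1 ≤ M) (hM : ∀ z, ‖z‖ = 1 → ‖g z‖ ≤ M) {ε : ℝ} (hε : 0 < ε)
    {z₀ : E} (hz₀ : 1 ≤ ‖z₀‖) : ‖g z₀‖ ≤ M * ‖z₀‖ ^ (1 + ε) := by
  have : ProperSpace E := FiniteDimensional.proper ℂ E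
  by_contra! hlt
  set Ψ : E → ℝ := fun z => Real.log (‖g z‖ ^ 2) - (1 + ε) * Real.log (‖z‖ ^ 2) with hΨ
  have hgc := hg.continuous
  set K : Set E := {z | ‖z‖ ≤ ‖z₀‖ ∧ 1 ≤ ‖z‖ ∧ ‖z‖ ≤ ‖g z‖} with hK
  have hKc : IsCompact K := by
    refine (isCompact_closedBall (0 : E) ‖z₀‖).of_isClosed_subset ?_ fun z hz => by simpa using hz.1
    have e1 : IsClosed {z : E | ‖z‖ ≤ ‖z₀‖} := isClosed_le (by fun_prop) (by fun_prop)
    have e2 : IsClosed {z : E | 1 ≤ ‖z‖} := isClosed_le (by fun_prop) (by fun_prop)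
    have e3 : IsClosed {z : E | ‖z‖ ≤ ‖g z‖} := isClosed_le (by fun_prop) (by fun_prop)
    exact e1.inter (e2.inter e3)
  have hΨc : ContinuousOn Ψ K := by
    refine ContinuousOn.sub (ContinuousOn.log (by fun_prop) fun z hz => ?_)
      (continuousOn_const.mul (ContinuousOn.log (by fun_prop) fun z hz => ?_))
    · exact pow_ne_zero _ (by linarith [hz.2.1, hz.2.2])
    · exact pow_ne_zero _ (by linarith [hz.2.1])
  have hpow : ‖z₀‖ ≤ ‖z₀‖ ^ (1 + ε) := by
    simpa using Real.rpow_le_rpow_of_exponent_le hz₀ (show (1 : ℝ) ≤ 1 + ε by linarith)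
  have hz₀K : z₀ ∈ K := by
    refine ⟨le_rfl, hz₀, ?_⟩
    nlinarith
  obtain ⟨z, hzK, hmax⟩ := hKc.exists_isMaxOn ⟨z₀, hz₀K⟩ hΨc
  have hΨz₀ : 2 * Real.log M < Ψ z₀ := by
    have h1 := Real.log_lt_log (by positivity) hlt
    rw [Real.log_mul (by positivity) (by positivity), Real.log_rpow (by linarith)] at h1
    simp only [hΨ, Real.log_pow, Nat.cast_ofNat]
    linarith
  have hΨz : 2 * Real.log M < Ψ z := hΨz₀.trans_le (hmax hz₀K)
  have hlogM := Real.log_nonneg hM1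
  have hz1 : 1 < ‖z‖ := by
    refine lt_of_le_of_ne hzK.2.1 fun he => ?_
    have h1 := Real.log_le_log (by linarith [hzK.2.1, hzK.2.2]) (hM z he.symm)
    simp only [hΨ, Real.log_pow, Nat.cast_ofNat, ← he, Real.log_one] at hΨz
    linarith
  have hlogz := Real.log_pos hz1
  have hgz : ‖z‖ < ‖g z‖ := by
    refine lt_of_le_of_ne hzK.2.2 fun he => ?_
    simp only [hΨ, Real.log_pow, Nat.cast_ofNat, ← he] at hΨz
    nlinarith
  have hz0 : z ≠ 0 := norm_pos_iff.1 (by linarith)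
  have hgpos : 0 < ‖g z‖ := by linarith
  set b : ℝ := (1 + ε) * ‖g z‖ ^ 2 / ‖z‖ ^ 2 with hb
  have hkey : ∀ ξ : E, (inner ℂ z ξ).re < 0 →
      (inner ℂ (g z) (fderiv ℂ g z ξ)).re ≤ b * (inner ℂ z ξ).re := by
    intro ξ hξ
    let _ : InnerProductSpace ℝ E := InnerProductSpace.rclikeToReal ℂ E
    have hγ : HasDerivAt (fun t : ℝ => z + t • ξ) ξ 0 := by
      simpa using ((hasDerivAt_id (0 : ℝ)).smul_const ξ).const_add z
    have hgγ : HasDerivAt (fun t : ℝ => g (z + t • ξ)) (fderiv ℂ g z ξ) 0 := by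
      have h1 : HasFDerivAt g ((fderiv ℂ g z).restrictScalars ℝ) (z + (0 : ℝ) • ξ) := by
        simpa using (hg z).hasFDerivAt.restrictScalars ℝ
      exact h1.comp_hasDerivAt (0 : ℝ) hγ
    have hN1 := hγ.norm_sq
    have hN2 := hgγ.norm_sq
    simp only [zero_smul, add_zero, real_inner_eq_re_inner ℂ] at hN1 hN2
    have hφ := (hN2.log (by simpa using hgpos.ne')).sub
      ((hN1.log (by simpa using hz0)).const_mul (1 + ε))
    simp only [zero_smul, add_zero] at hφ
    have hcont : Tendsto (fun t : ℝ => z + t • ξ) (𝓝[>] 0) (𝓝 z) := by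
      have := hγ.continuousAt.tendsto
      simp only [zero_smul, add_zero] at this
      exact this.mono_left nhdsWithin_le_nhds
    have hdec : ∀ᶠ t : ℝ in 𝓝[>] 0, ‖z + t • ξ‖ ^ 2 < ‖z‖ ^ 2 := by
      have h1 := (hasDerivAt_iff_tendsto_slope.1 hN1).eventually_lt_const
        (show 2 * RCLike.re (inner ℂ z ξ) < 0 by
          have : RCLike.re (inner ℂ z ξ) < 0 := hξ
          linarith)
      filter_upwards [h1.filter_mono (nhdsWithin_mono 0 fun t ht => ne_of_gt ht),
        self_mem_nhdsWithin] with t ht htc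
      rw [slope_def_field, div_lt_iff₀ (sub_pos.2 htc)] at ht
      simp only [zero_smul, add_zero, zero_mul] at ht
      linarith
    have hmem : ∀ᶠ t : ℝ in 𝓝[>] 0, z + t • ξ ∈ K := by
      have h1 : ∀ᶠ x in 𝓝 z, 1 < ‖x‖ ∧ ‖x‖ < ‖g x‖ :=
        inter_mem ((isOpen_lt continuous_const continuous_norm).mem_nhds hz1)
          ((isOpen_lt continuous_norm hgc.norm).mem_nhds hgz)
      filter_upwards [hdec, hcont.eventually h1] with t ht1 ht2
      exact ⟨(lt_of_pow_lt_pow_left₀ 2 (norm_nonneg _) ht1).le.trans hzK.1, ht2.1.le, ht2.2.le⟩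
    have hle : 2 * RCLike.re (inner ℂ (g z) (fderiv ℂ g z ξ)) / ‖g z‖ ^ 2 -
        (1 + ε) * (2 * RCLike.re (inner ℂ z ξ) / ‖z‖ ^ 2) ≤ 0 := by
      refine le_of_tendsto ((hasDerivAt_iff_tendsto_slope.1 hφ).mono_left
        (show 𝓝[>] (0 : ℝ) ≤ 𝓝[≠] 0 from nhdsWithin_mono 0 fun t ht => ne_of_gt ht)) ?_
      filter_upwards [hmem, self_mem_nhdsWithin] with t ht htc
      have h1 : Ψ (z + t • ξ) ≤ Ψ z := hmax ht
      rw [slope_def_field]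
      refine div_nonpos_of_nonpos_of_nonneg ?_ (sub_nonneg.2 (le_of_lt htc))
      simp only [hΨ] at h1
      simp only [Pi.sub_apply, zero_smul, add_zero]
      linarith
    have h2 : 2 * RCLike.re (inner ℂ (g z) (fderiv ℂ g z ξ)) / ‖g z‖ ^ 2 ≤
        (1 + ε) * (2 * RCLike.re (inner ℂ z ξ) / ‖z‖ ^ 2) := by linarith
    rw [div_le_iff₀ (by positivity)] at h2
    change RCLike.re (inner ℂ (g z) (fderiv ℂ g z ξ)) ≤ b * RCLike.re (inner ℂ z ξ)
    have h3 : b * RCLike.re (inner ℂ z ξ) =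
        (1 + ε) * (2 * RCLike.re (inner ℂ z ξ) / ‖z‖ ^ 2) * ‖g z‖ ^ 2 / 2 := by
      rw [hb]; ring
    rw [h3]
    linarith
  obtain ⟨h1, h2⟩ := eq_smul_of_forall_re_neg_le hz0
    ((innerSL ℂ (g z)).comp (fderiv ℂ g z)).toLinearMap (by positivity) hkey
  have h3 := H z _ (by linarith) hgz h1
  have hzsq : (0 : ℝ) < ‖z‖ ^ 2 := by have := norm_pos_iff.2 hz0; positivity
  rw [norm_div, norm_pow, Complex.norm_real, norm_norm, div_mul_cancel₀ _ hzsq.ne'] at h3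
  rw [hb, div_mul_cancel₀ _ hzsq.ne'] at h2
  have h4 := h2.trans ((Complex.re_le_norm _).trans h3)
  have : 0 < ε * ‖g z‖ ^ 2 := by positivity
  linarith

theorem linear_growth_of_inner_fderiv {E : Type*} [NormedAddCommGroup E]
    [InnerProductSpace ℂ E] [FiniteDimensional ℂ E] {g : E → E} (hg : Differentiable ℂ g)
    (H : ∀ p κ, 0 < ‖p‖ → ‖p‖ < ‖g p‖ →
      (∀ y, inner ℂ (g p) (fderiv ℂ g p y) = κ * inner ℂ p y) → ‖κ‖ * ‖p‖ ^ 2 ≤ ‖g p‖ ^ 2) :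
    ∃ C, ∀ z, ‖g z‖ ≤ C * (1 + ‖z‖) := by
  have : ProperSpace E := FiniteDimensional.proper ℂ E
  obtain ⟨M, hM⟩ := (isCompact_closedBall (0 : E) 1).exists_bound_of_continuousOn
    hg.continuous.continuousOn
  refine ⟨max M 1, fun z => ?_⟩
  have hM' : ∀ z, ‖z‖ = 1 → ‖g z‖ ≤ max M 1 := fun z hz =>
    (hM z (by simp [hz])).trans (le_max_left _ _)
  have h1 := le_max_right M 1
  rcases le_or_gt ‖z‖ 1 with hz | hz
  · have := (hM z (by simpa using hz)).trans (le_max_left M 1)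
    nlinarith [norm_nonneg z]
  · have hlim : Tendsto (fun ε : ℝ => max M 1 * ‖z‖ ^ (1 + ε)) (𝓝[>] 0) (𝓝 (max M 1 * ‖z‖)) := by
      have hc : Continuous fun ε : ℝ => max M 1 * ‖z‖ ^ (1 + ε) :=
        continuous_const.mul (Real.continuous_const_rpow (by linarith) |>.comp (by fun_prop))
      have := hc.tendsto 0
      simp only [add_zero, Real.rpow_one] at this
      exact this.mono_left nhdsWithin_le_nhds
    have h2 : ‖g z‖ ≤ max M 1 * ‖z‖ := ge_of_tendsto hlim <| by
      filter_upwards [self_mem_nhdsWithin] with ε hε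
      exact norm_le_mul_rpow_of_inner_fderiv hg H h1 hM' hε hz.le
    linarith

theorem exists_unitary_det_eq_one_mulVec_single {d : ℕ} (hd : 2 ≤ d)
    {x : EuclideanSpace ℂ (Fin d)} (hx : ‖x‖ = 1) :
    ∃ Q : Matrix (Fin d) (Fin d) ℂ, Q.conjTranspose * Q = 1 ∧ Q.det = 1 ∧
      Q.mulVec (Pi.single ⟨0, by omega⟩ 1) = WithLp.ofLp x := by
  set i₀ : Fin d := ⟨0, by omega⟩ with hi₀
  set i₁ : Fin d := ⟨1, by omega⟩ with hi₁
  have hne : i₀ ≠ i₁ := by simp [hi₀, hi₁]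
  have hon : Orthonormal ℂ (Set.domRestrict {i₀} fun _ : Fin d => x) := by
    rw [orthonormal_iff_ite]
    rintro ⟨i, hi⟩ ⟨j, hj⟩
    obtain rfl : i = i₀ := hi
    obtain rfl : j = i₀ := hj
    simp [Set.domRestrict, inner_self_eq_norm_sq_to_K, hx]
  obtain ⟨b, hb⟩ := hon.exists_orthonormalBasis_extension_of_card_eq (by simp)
  set P : Matrix (Fin d) (Fin d) ℂ :=
    (EuclideanSpace.basisFun (Fin d) ℂ).toBasis.toMatrix b with hP
  have hPu : P ∈ Matrix.unitaryGroup (Fin d) ℂ :=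
    (EuclideanSpace.basisFun (Fin d) ℂ).toMatrix_orthonormalBasis_mem_unitary b
  have hPP : P.conjTranspose * P = 1 := (Matrix.mem_unitaryGroup_iff').1 hPu
  have hdet : star P.det * P.det = 1 := by
    have := congrArg Matrix.det hPP
    rwa [Matrix.det_mul, Matrix.det_conjTranspose, Matrix.det_one] at this
  set D : Matrix (Fin d) (Fin d) ℂ :=
    Matrix.diagonal (Function.update (1 : Fin d → ℂ) i₁ (star P.det)) with hD
  have hDD : D.conjTranspose * D = 1 := by
    rw [hD, Matrix.diagonal_conjTranspose, Matrix.diagonal_mul_diagonal, ← Matrix.diagonal_one]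
    congr 1
    funext i
    rcases eq_or_ne i i₁ with rfl | hi
    · simpa using (mul_comm _ _).trans hdet
    · simp [hi]
  refine ⟨P * D, ?_, ?_, ?_⟩
  · rw [Matrix.conjTranspose_mul, Matrix.mul_assoc, ← Matrix.mul_assoc P.conjTranspose, hPP,
      Matrix.one_mul, hDD]
  · rw [Matrix.det_mul, hD, Matrix.det_diagonal, Finset.prod_update_of_mem (Finset.mem_univ _)]
    simpa using (mul_comm _ _).trans hdet
  · funext i
    have h1 : b i₀ = x := hb i₀ rfl
    rw [Matrix.mulVec_single_one, Matrix.col_apply, hD, Matrix.mul_diagonal,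
      Function.update_of_ne hne, hP, Module.Basis.toMatrix_apply, h1]
    simp

theorem exists_unitary_det_eq_one_mulVec_eq {d : ℕ} (hd : 2 ≤ d)
    {x y : EuclideanSpace ℂ (Fin d)} (hx : ‖x‖ = 1) (hy : ‖y‖ = 1) :
    ∃ U : Matrix (Fin d) (Fin d) ℂ, U.conjTranspose * U = 1 ∧ U.det = 1 ∧
      U.mulVec (WithLp.ofLp x) = WithLp.ofLp y := by
  obtain ⟨Q, hQ, hQd, hQx⟩ := exists_unitary_det_eq_one_mulVec_single hd hx
  obtain ⟨P, hP, hPd, hPy⟩ := exists_unitary_det_eq_one_mulVec_single hd hy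
  have hQ' : Q * Q.conjTranspose = 1 := mul_eq_one_comm.1 hQ
  refine ⟨P * Q.conjTranspose, ?_, ?_, ?_⟩
  · rw [Matrix.conjTranspose_mul, Matrix.conjTranspose_conjTranspose, Matrix.mul_assoc,
      ← Matrix.mul_assoc P.conjTranspose, hP, Matrix.one_mul, hQ']
  · rw [Matrix.det_mul, Matrix.det_conjTranspose, hPd, hQd, star_one, mul_one]
  · rw [← hQx, Matrix.mulVec_mulVec, Matrix.mul_assoc, hQ, Matrix.mul_one, hPy]

theorem norm_eigenvalue_le_one_of_bounded_composition_unitary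
    {d : ℕ} {V : Type*} [NormedAddCommGroup V] [NormedSpace ℂ V]
    (ι : V →ₗ[ℂ] ((Fin d → ℂ) → ℂ))
    (hent : ∀ h : V, Differentiable ℂ (ι h))
    (hbd : ∀ K : Set (Fin d → ℂ), IsCompact K →
      ∃ C : ℝ, 0 ≤ C ∧ ∀ h : V, ∀ z ∈ K, ‖ι h z‖ ≤ C * ‖h‖)
    {p : Fin d → ℂ}
    (hII : {n : ℕ | ∀ h : (Fin d → ℂ) → ℂ, Differentiable ℂ h →
        (∀ k < n, iteratedFDeriv ℂ k h p = 0) →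
        ∃ v : V, ∀ k < n + 1,
          iteratedFDeriv ℂ k (fun z => ι v z - h z) p = 0}.Infinite)
    {c : ℂ} {U : Matrix (Fin d) (Fin d) ℂ}
    (hU : ∃ v : (Fin d → ℂ) → ℂ, Differentiable ℂ v ∧ (∀ z, v z ≠ 0) ∧
        ∃ T : V →L[ℂ] V, ∀ h : V, ι (T h) = fun z => v z * ι h (c • U.mulVec z))
    {f : (Fin d → ℂ) → (Fin d → ℂ)} (hf : Differentiable ℂ f)
    {u : (Fin d → ℂ) → ℂ} (hu : Differentiable ℂ u) (hu0 : ∀ z, u z ≠ 0)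
    {T : V →L[ℂ] V} (hT : ∀ h : V, ι (T h) = fun z => u z * ι h (f z))
    (hp : c • U.mulVec (f p) = p)
    {ξ : (Fin d → ℂ) →L[ℂ] ℂ} (hξ : ξ ≠ 0) {μ : ℂ}
    (hμ : ∀ y, ξ (c • U.mulVec (fderiv ℂ f p y)) = μ * ξ y) : ‖μ‖ ≤ 1 := by
  obtain ⟨v, hv, hv0, S, hS⟩ := hU
  set L : (Fin d → ℂ) →L[ℂ] (Fin d → ℂ) :=
    LinearMap.toContinuousLinearMap (c • U.mulVecLin) with hL
  have hLx : ∀ x, L x = c • U.mulVec x := fun x => by simp [hL]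
  refine norm_eigenvalue_le_one_of_bounded_weighted_composition ι hent hbd hII
    (g := fun z => L (f z)) (g' := L.comp (fderiv ℂ f p))
    (L.hasFDerivAt.comp p (hf p).hasFDerivAt) (by rw [hLx, hp])
    (w := fun z => u z * v (f z)) ?_ (mul_ne_zero (hu0 _) (hv0 _)) (T.comp S) ?_ hξ (μ := μ) ?_
  · exact (hu.continuous.mul (hv.continuous.comp hf.continuous)).continuousAt
  · intro h
    funext z
    simp [hT, hS, hLx, mul_assoc]
  · intro y
    rw [ContinuousLinearMap.comp_apply, hLx, hμ]

theorem linear_growth_of_fin_one {f : (Fin 1 → ℂ) → (Fin 1 → ℂ)} (hf : Differentiable ℂ f)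
    (H : ∀ (c : ℝ) (p : Fin 1 → ℂ), 1 < c → f p = (c : ℂ) • p →
      ∀ (ξ : (Fin 1 → ℂ) →L[ℂ] ℂ) (μ : ℂ), ξ ≠ 0 →
        (∀ y, ξ (fderiv ℂ f p y) = c * (μ * ξ y)) → ‖μ‖ ≤ 1) :
    ∃ C, ∀ z, ‖f z‖ ≤ C * (1 + ‖z‖) := by
  set j : ℂ →L[ℂ] (Fin 1 → ℂ) := ContinuousLinearMap.pi fun _ => ContinuousLinearMap.id ℂ ℂ with hj
  set π : (Fin 1 → ℂ) →L[ℂ] ℂ := ContinuousLinearMap.proj 0 with hπ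
  have hjπ : ∀ y, j (π y) = y := fun y => by
    funext i
    rw [Subsingleton.elim i 0]
    rfl
  have hnorm : ∀ y, ‖π y‖ = ‖y‖ := fun y => by simp [hπ, Pi.norm_def]
  set φ : ℂ → ℂ := fun t => π (f (j t)) with hφ
  have hφd : ∀ t, HasDerivAt φ (π (fderiv ℂ f (j t) (j 1))) t := fun t =>
    (π.hasFDerivAt.comp_hasDerivAt t ((hf (j t)).hasFDerivAt.comp_hasDerivAt t j.hasDerivAt))
  have hφdiff : Differentiable ℂ φ := fun t => (hφd t).differentiableAt
  obtain ⟨B, hB⟩ := exists_forall_ne_real_mul hφdiff fun t c hc ht htc => by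
    have hc0 : (c : ℂ) ≠ 0 := by
      exact_mod_cast (by linarith : c ≠ 0)
    have h1 := H c (j t) hc (by
      rw [← hjπ (f (j t)), show π (f (j t)) = c * t from htc, ← smul_eq_mul, map_smul]) π
      (deriv φ t / c) (fun h => by
        have := congrArg (fun L => L (j 1)) h
        simp [hπ, hj] at this) (fun y => by
        rw [(hφd t).deriv]
        conv_lhs => rw [← hjπ y, ← mul_one (π y), ← smul_eq_mul, map_smul, map_smul, map_smul]
        rw [smul_eq_mul]
        field_simp)
    rwa [norm_div, Complex.norm_real, Real.norm_of_nonneg (by linarith),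
      div_le_one (by linarith)] at h1
  obtain ⟨C, hC⟩ := linear_growth_of_forall_ne_real_mul hφdiff hB
  refine ⟨C, fun z => ?_⟩
  have := hC (π z)
  simpa only [hφ, hjπ, hnorm] using this

theorem linear_growth_of_two_le {d : ℕ} (hd : 2 ≤ d) {f : (Fin d → ℂ) → (Fin d → ℂ)}
    (hf : Differentiable ℂ f)
    (H : ∀ (a : ℝ) (U : Matrix (Fin d) (Fin d) ℂ) (p : Fin d → ℂ), 0 < a → a < 1 →
      U.conjTranspose * U = 1 → U.det = 1 → (a : ℂ) • U.mulVec (f p) = p →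
      ∀ (ξ : (Fin d → ℂ) →L[ℂ] ℂ) (μ : ℂ), ξ ≠ 0 →
        (∀ y, ξ ((a : ℂ) • U.mulVec (fderiv ℂ f p y)) = μ * ξ y) → ‖μ‖ ≤ 1) :
    ∃ C, ∀ z, ‖f z‖ ≤ C * (1 + ‖z‖) := by
  set e : EuclideanSpace ℂ (Fin d) ≃L[ℂ] (Fin d → ℂ) := EuclideanSpace.equiv (Fin d) ℂ with he
  set g : EuclideanSpace ℂ (Fin d) → EuclideanSpace ℂ (Fin d) := fun z => e.symm (f (e z)) with hg
  have hgd : ∀ z, HasFDerivAt g ((e.symm : (Fin d → ℂ) →L[ℂ] _).comp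
      ((fderiv ℂ f (e z)).comp (e : _ →L[ℂ] (Fin d → ℂ)))) z := fun z =>
    e.symm.hasFDerivAt.comp z ((hf (e z)).hasFDerivAt.comp z e.hasFDerivAt)
  obtain ⟨C, hC⟩ := linear_growth_of_inner_fderiv (g := g)
    (fun z => (hgd z).differentiableAt) fun p κ hp hlt hκ => by
    have hgp : 0 < ‖g p‖ := hp.trans hlt
    have hunit : ∀ x : EuclideanSpace ℂ (Fin d), 0 < ‖x‖ → ‖((‖x‖ : ℂ))⁻¹ • x‖ = 1 := fun x hx => by
      rw [norm_smul, norm_inv, Complex.norm_real, norm_norm, inv_mul_cancel₀ hx.ne']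
    obtain ⟨U, hU, hUd, hUx⟩ := exists_unitary_det_eq_one_mulVec_eq hd
      (hunit (g p) hgp) (hunit p hp)
    set a : ℝ := ‖p‖ / ‖g p‖ with ha
    have hgp' : (‖g p‖ : ℂ) ≠ 0 := by exact_mod_cast hgp.ne'
    have hp' : (‖p‖ : ℂ) ≠ 0 := by exact_mod_cast hp.ne'
    have hfix : (a : ℂ) • U.mulVec (f (e p)) = e p := by
      have h1 := congrArg (fun x => (‖p‖ : ℂ) • x) hUx
      simp only [WithLp.ofLp_smul, Matrix.mulVec_smul, smul_smul] at h1
      rw [mul_inv_cancel₀ hp', one_smul] at h1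
      rw [ha, Complex.ofReal_div, div_eq_mul_inv]
      exact h1
    have hinner : ∀ y : Fin d → ℂ, inner ℂ p (e.symm ((a : ℂ) • U.mulVec y)) =
        (a : ℂ) ^ 2 * inner ℂ (g p) (e.symm y) := by
      intro y
      have h2 : U.conjTranspose.mulVec (e p) = (a : ℂ) • f (e p) := by
        conv_lhs => rw [← hfix]
        rw [Matrix.mulVec_smul, Matrix.mulVec_mulVec, hU, Matrix.one_mulVec]
      have h3 : inner ℂ p (e.symm ((a : ℂ) • U.mulVec y)) =
          ((a : ℂ) • U.mulVec y) ⬝ᵥ star (e p) := rfl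
      have h4 : inner ℂ (g p) (e.symm y) = y ⬝ᵥ star (f (e p)) := rfl
      have h5 : Matrix.vecMul (star (e p)) U = (a : ℂ) • star (f (e p)) := by
        rw [← Matrix.conjTranspose_conjTranspose U, ← Matrix.star_mulVec, h2, star_smul]
        simp
      rw [h3, h4, smul_dotProduct, dotProduct_comm, Matrix.dotProduct_mulVec, h5, smul_dotProduct,
        dotProduct_comm]
      simp only [smul_eq_mul]
      ring
    have hone := H a U (e p) (by positivity) ((div_lt_one hgp).2 hlt) hU hUd hfix
      ((innerSL ℂ p).comp (e.symm : (Fin d → ℂ) →L[ℂ] _)) ((a : ℂ) ^ 2 * κ)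
      (fun h0 => by
        have := congrArg (fun L => L (e p)) h0
        simp at this
        simp [this] at hp)
      (fun y => by
        have h6 := hκ (e.symm y)
        rw [(hgd p).fderiv] at h6
        simp only [ContinuousLinearMap.comp_apply, ContinuousLinearEquiv.coe_coe,
          ContinuousLinearEquiv.apply_symm_apply] at h6
        change inner ℂ p (e.symm _) = _ * inner ℂ p (e.symm y)
        rw [hinner, h6]
        ring)
    rw [norm_mul, norm_pow, Complex.norm_real, Real.norm_of_nonneg (by positivity), ha, div_pow,
      div_mul_eq_mul_div, div_le_one (by positivity)] at hone
    linarith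
  set n₁ := ‖(e : EuclideanSpace ℂ (Fin d) →L[ℂ] (Fin d → ℂ))‖ with hn₁
  set n₂ := ‖(e.symm : (Fin d → ℂ) →L[ℂ] EuclideanSpace ℂ (Fin d))‖ with hn₂
  have hC0 : 0 ≤ C := by simpa using (norm_nonneg _).trans (hC 0)
  refine ⟨n₁ * (C * (1 + n₂)), fun z => ?_⟩
  have h1 := (e : EuclideanSpace ℂ (Fin d) →L[ℂ] (Fin d → ℂ)).le_opNorm (g (e.symm z))
  have h2 := (e.symm : (Fin d → ℂ) →L[ℂ] EuclideanSpace ℂ (Fin d)).le_opNorm z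
  have h3 := hC (e.symm z)
  have h4 : e (g (e.symm z)) = f z := by simp [hg]
  simp only [ContinuousLinearEquiv.coe_coe, h4] at h1 h2
  have hn₁0 : 0 ≤ n₁ := norm_nonneg _
  have hn₂0 : 0 ≤ n₂ := norm_nonneg _
  calc ‖f z‖ ≤ n₁ * ‖g (e.symm z)‖ := h1
    _ ≤ n₁ * (C * (1 + n₂ * ‖z‖)) := by gcongr; exact h3.trans (by gcongr)
    _ ≤ n₁ * (C * ((1 + n₂) * (1 + ‖z‖))) := by
      gcongr
      nlinarith [norm_nonneg z]
    _ = _ := by ring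

/-- affine rigidity from boundedness on ℂ^d. Under Assumption (II) at every
point and boundedness of weighted composition operators with symbols `a • U` for every
`0 < a < 1` and `U ∈ SU(d)`, every bounded weighted composition operator with nonvanishing
weight has affine symbol. -/
theorem affine_rigidity_from_boundedness
    {d : ℕ} {V : Type*} [NormedAddCommGroup V] [NormedSpace ℂ V] [CompleteSpace V]
    (ι : V →ₗ[ℂ] ((Fin d → ℂ) → ℂ)) (hinj : Function.Injective ι)
    (hent : ∀ h : V, Differentiable ℂ (ι h))
    (hbd : ∀ K : Set (Fin d → ℂ), IsCompact K →
      ∃ C : ℝ, 0 ≤ C ∧ ∀ h : V, ∀ z ∈ K, ‖ι h z‖ ≤ C * ‖h‖)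
    (hII : ∀ p : Fin d → ℂ,
      {n : ℕ | ∀ h : (Fin d → ℂ) → ℂ, Differentiable ℂ h →
        (∀ k < n, iteratedFDeriv ℂ k h p = 0) →
        ∃ v : V, ∀ k < n + 1,
          iteratedFDeriv ℂ k (fun z => ι v z - h z) p = 0}.Infinite)
    (hSU : ∀ a : ℝ, 0 < a → a < 1 → ∀ U : Matrix (Fin d) (Fin d) ℂ,
      U.conjTranspose * U = 1 → U.det = 1 →
      ∃ v : (Fin d → ℂ) → ℂ, Differentiable ℂ v ∧ (∀ z, v z ≠ 0) ∧
        ∃ T : V →L[ℂ] V, ∀ h : V,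
          ι (T h) = fun z => v z * ι h ((a : ℂ) • U.mulVec z))
    (f : (Fin d → ℂ) → (Fin d → ℂ)) (hf : Differentiable ℂ f)
    (u : (Fin d → ℂ) → ℂ) (hu : Differentiable ℂ u) (hu0 : ∀ z, u z ≠ 0)
    (T : V →L[ℂ] V) (hT : ∀ h : V, ι (T h) = fun z => u z * ι h (f z)) :
    ∃ (A : (Fin d → ℂ) →ₗ[ℂ] (Fin d → ℂ)) (b : Fin d → ℂ), ∀ z, f z = A z + b := by
  have H := fun (a : ℝ) (U : Matrix (Fin d) (Fin d) ℂ) (p : Fin d → ℂ) (ha : 0 < a) (ha1 : a < 1)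
      (hU : U.conjTranspose * U = 1) (hUd : U.det = 1) (hfix : (a : ℂ) • U.mulVec (f p) = p)
      (ξ : (Fin d → ℂ) →L[ℂ] ℂ) (μ : ℂ) (hξ : ξ ≠ 0) =>
    norm_eigenvalue_le_one_of_bounded_composition_unitary ι hent hbd (hII p)
      (hSU a ha ha1 U hU hUd) hf hu hu0 hT hfix hξ (μ := μ)
  suffices hgrowth : ∃ C, ∀ z, ‖f z‖ ≤ C * (1 + ‖z‖) by
    obtain ⟨C, hC⟩ := hgrowth
    exact ⟨(fderiv ℂ f 0).toLinearMap, f 0, fun z => eq_add_fderiv_of_linear_growth hf hC z⟩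
  match d, f, hf, H with
  | 0, f, _, _ => exact ⟨0, fun z => by simp [Subsingleton.elim (f z) 0]⟩
  | 1, f, hf, H =>
    refine linear_growth_of_fin_one hf fun c p hc hp ξ μ hξ hμ => ?_
    have hc0 : (c : ℂ) ≠ 0 := by
      exact_mod_cast (by linarith : c ≠ 0)
    refine H c⁻¹ 1 p (inv_pos.2 (by linarith)) (inv_lt_one_of_one_lt₀ hc) (by simp) (by simp)
      ?_ ξ μ hξ fun y => ?_
    · rw [Matrix.one_mulVec, hp, Complex.ofReal_inv, inv_smul_smul₀ hc0]
    · rw [Matrix.one_mulVec, Complex.ofReal_inv, map_smul, hμ, smul_eq_mul,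
        inv_mul_cancel_left₀ hc0]
  | d + 2, f, hf, H => exact linear_growth_of_two_le (by omega) hf H
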